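/- arXiv:2312.03287 — 2 statements merged into one kernel-verified Lean document; each statement's English description precedes it below -/
import Mathlib

section
/- Let P^{γαβ} (γ,α,β ∈ {0,1,2}) be constants satisfying the null condition. Then for any sufficiently smooth functions u, v supported in the cone K, one has the pointwise estimate on K: |P^{γαβ}∂_γ∂_αv ∂_βu| ≲ (s²/t²)|∂_t∂_tv ∂_tu| + (1/t) Σ_{|I₁|≤1, |I₂|=1} |∂Γ^{I₁}v||Γ^{I₂}u|, where s = √(t²−|x|²) and the implied constant depends only on the P^{γαβ}. -/
open MeasureTheory Real Filter Topology
open scoped ENNReal NNReal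

noncomputable section

/-- A spacetime point in `ℝ^{1+2}`: coordinates `(x₀, x₁, x₂)` with `t = x₀`. -/
abbrev Pt : Type := Fin 3 → ℝ

/-- The `i`-th standard basis vector of `ℝ^{1+2}`. -/
def e3 (i : Fin 3) : Pt := Pi.single i 1

/-- Partial derivative `∂_i`. -/
def pd (i : Fin 3) (u : Pt → ℝ) : Pt → ℝ := fun p => fderiv ℝ u p (e3 i)

/-- Spatial radius `r = |x|`. -/
def rad (p : Pt) : ℝ := Real.sqrt ((p 1) ^ 2 + (p 2) ^ 2)

/-- Hyperbolic time `s = √(t² − |x|²)`. -/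
def sVar (p : Pt) : ℝ := Real.sqrt ((p 0) ^ 2 - (p 1) ^ 2 - (p 2) ^ 2)

/-- The cone `K = {(t,x) : t ≥ 2, |x| < t − 1}`. -/
def Cone : Set Pt := {p | 2 ≤ p 0 ∧ rad p < p 0 - 1}

/-- Lorentz boost `L_a = x_a ∂_t + t ∂_a`, `a ∈ {1,2}`. -/
def Lb (a : Fin 2) (u : Pt → ℝ) : Pt → ℝ :=
  fun p => p a.succ * pd 0 u p + p 0 * pd a.succ u p

/-- Semi-hyperboloidal derivative `∂̲_a = (x_a/t)∂_t + ∂_a`. -/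
def dund (a : Fin 2) (u : Pt → ℝ) : Pt → ℝ :=
  fun p => (p a.succ / p 0) * pd 0 u p + pd a.succ u p

/-- The ordered family `{Γ_k} = {∂₀, ∂₁, ∂₂, L₁, L₂}`. -/
def Gam : Fin 5 → (Pt → ℝ) → (Pt → ℝ) := ![pd 0, pd 1, pd 2, Lb 0, Lb 1]

/-- `Γ^I = Π_k Γ_k^{i_k}` for a multi-index `I ∈ ℕ⁵`. -/
def GamI (I : Fin 5 → ℕ) : (Pt → ℝ) → (Pt → ℝ) :=
  (Gam 0)^[I 0] ∘ (Gam 1)^[I 1] ∘ (Gam 2)^[I 2] ∘ (Gam 3)^[I 3] ∘ (Gam 4)^[I 4]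

/-- Length `|I|` of a multi-index. -/
def mlen (I : Fin 5 → ℕ) : ℕ := ∑ k, I k

/-- The (finite) set of multi-indices `I ∈ ℕ⁵` with `|I| ≤ n`. -/
def midxLe (n : ℕ) : Finset (Fin 5 → ℕ) :=
  (Fintype.piFinset fun _ => Finset.range (n + 1)).filter fun I => mlen I ≤ n

/-- The (finite) set of multi-indices `I ∈ ℕ⁵` with `|I| = 1`. -/
def midxEq1 : Finset (Fin 5 → ℕ) :=
  (Fintype.piFinset fun _ => Finset.range 2).filter fun I => mlen I = 1

/-- `|∂u| = (Σ_α |∂_α u|²)^{1/2}`. -/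
def pdNorm (u : Pt → ℝ) (p : Pt) : ℝ := Real.sqrt (∑ α, (pd α u p) ^ 2)

/-- The wave operator `□ = −∂_t² + ∂₁² + ∂₂²`. -/
def box (u : Pt → ℝ) : Pt → ℝ :=
  fun p => - pd 0 (pd 0 u) p + pd 1 (pd 1 u) p + pd 2 (pd 2 u) p

/-- The null condition for constants `P^{γαβ}`. -/
def NullCond (P : Fin 3 → Fin 3 → Fin 3 → ℝ) : Prop :=
  ∀ ξ : Fin 3 → ℝ, ξ 0 ^ 2 = ξ 1 ^ 2 + ξ 2 ^ 2 →
    ∑ γ, ∑ α, ∑ β, P γ α β * ξ γ * ξ α * ξ β = 0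

/-- The symmetry condition `P^{γαβ} = P^{γβα}`. -/
def SymmCond (P : Fin 3 → Fin 3 → Fin 3 → ℝ) : Prop := ∀ γ α β, P γ α β = P γ β α

/-- Null form `N(w,z) = P^{γαβ} ∂_γ w ∂_α∂_β z`. -/
def Nform (P : Fin 3 → Fin 3 → Fin 3 → ℝ) (w z : Pt → ℝ) : Pt → ℝ :=
  fun p => ∑ γ, ∑ α, ∑ β, P γ α β * pd γ w p * pd α (pd β z) p

/-- The point of the hyperboloid `H_s` above `x ∈ ℝ²`. -/
def hypPt (s : ℝ) (x : Fin 2 → ℝ) : Pt :=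
  ![Real.sqrt (s ^ 2 + (x 0) ^ 2 + (x 1) ^ 2), x 0, x 1]

/-- `‖u‖_{L²_f(H_s)}`. -/
def L2H (u : Pt → ℝ) (s : ℝ) : ℝ :=
  (∫ x : Fin 2 → ℝ, (u (hypPt s x)) ^ 2) ^ (1 / 2 : ℝ)

/-- The hyperboloidal energy `E_m(u,s)`. -/
def Em (m : ℝ) (u : Pt → ℝ) (s : ℝ) : ℝ :=
  ∫ x : Fin 2 → ℝ,
    (((s / hypPt s x 0) * pd 0 u (hypPt s x)) ^ 2
      + ∑ a : Fin 2, (dund a u (hypPt s x)) ^ 2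
      + m ^ 2 * (u (hypPt s x)) ^ 2)

/-- `K₀ = s∂_s + 2x^a∂̲_a`, where `s∂_s = (s²/t)∂_t`. -/
def K0op (u : Pt → ℝ) : Pt → ℝ :=
  fun p => (sVar p) ^ 2 / p 0 * pd 0 u p + 2 * ∑ a : Fin 2, p a.succ * dund a u p

/-- The conformal energy `E_con(u,s)`. -/
def Econ (u : Pt → ℝ) (s : ℝ) : ℝ :=
  ∫ x : Fin 2 → ℝ,
    ((K0op u (hypPt s x) + u (hypPt s x)) ^ 2
      + ∑ a : Fin 2, (s * dund a u (hypPt s x)) ^ 2)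


/-- The coefficients `ω` in `∂_α = ω_α ∂_t + (1/t) L_α`: `ω₀ = 1` and `ω_a = -x_a/t`. -/
def frameCoeff (p : Pt) : Pt := Fin.cons 1 fun a => -(p a.succ / p 0)

lemma pd_comm {u : Pt → ℝ} (hu : ContDiff ℝ (⊤ : ℕ∞) u) (i j : Fin 3) (p : Pt) :
    pd i (pd j u) p = pd j (pd i u) p := by
  have hd : Differentiable ℝ (fderiv ℝ u) :=
    (hu.fderiv_right (m := (⊤ : ℕ∞)) (by simp)).differentiable (by simp)
  have key (i j : Fin 3) : pd i (pd j u) p = fderiv ℝ (fderiv ℝ u) p (e3 i) (e3 j) := by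
    unfold pd
    rw [fderiv_clm_apply (hd p) (differentiableAt_const _)]
    simp
  rw [key, key]
  have hs : IsSymmSndFDerivAt ℝ u p := hu.contDiffAt.isSymmSndFDerivAt (by
    rw [minSmoothness_of_isRCLikeNormedField]
    exact WithTop.coe_le_coe.mpr (le_top (a := (2 : ℕ∞))))
  exact hs _ _

lemma differentiable_pd {u : Pt → ℝ} (hu : ContDiff ℝ (⊤ : ℕ∞) u) (i : Fin 3) :
    Differentiable ℝ (pd i u) :=
  ((hu.fderiv_right (m := (⊤ : ℕ∞)) (by simp)).differentiable (by simp)).clm_apply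
    (differentiable_const _)

lemma pd_Lb {v : Pt → ℝ} (hv : ContDiff ℝ (⊤ : ℕ∞) v) (α : Fin 3) (c : Fin 2) (p : Pt) :
    pd α (Lb c v) p = p c.succ * pd α (pd 0 v) p + p 0 * pd α (pd c.succ v) p
      + e3 α c.succ * pd 0 v p + e3 α 0 * pd c.succ v p := by
  have hx (i : Fin 3) : HasFDerivAt (fun q : Pt => q i)
      (ContinuousLinearMap.proj (R := ℝ) (φ := fun _ : Fin 3 => ℝ) i) p :=
    (ContinuousLinearMap.proj (R := ℝ) (φ := fun _ : Fin 3 => ℝ) i).hasFDerivAt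
  have h := ((hx c.succ).mul (differentiable_pd hv 0 p).hasFDerivAt).add
    ((hx 0).mul (differentiable_pd hv c.succ p).hasFDerivAt)
  have h' : fderiv ℝ (Lb c v) p = _ := h.fderiv
  conv_lhs => unfold pd
  rw [h']
  simp only [add_apply, smul_apply,
    ContinuousLinearMap.proj_apply, smul_eq_mul, pd]
  ring

lemma abs_e3_le_one (i j : Fin 3) : |e3 i j| ≤ 1 := by
  unfold e3
  rw [Pi.single_apply]
  split_ifs <;> simp

lemma abs_pd_le_pdNorm (α : Fin 3) (u : Pt → ℝ) (p : Pt) : |pd α u p| ≤ pdNorm u p :=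
  Real.abs_le_sqrt (Finset.single_le_sum (f := fun α => (pd α u p) ^ 2)
    (fun _ _ => sq_nonneg _) (Finset.mem_univ α))

lemma GamI_zero (u : Pt → ℝ) : GamI 0 u = u := rfl

lemma GamI_single (k : Fin 5) (u : Pt → ℝ) : GamI (Pi.single k 1) u = Gam k u := by
  fin_cases k <;> rfl

lemma mlen_single (k : Fin 5) : mlen (Pi.single k 1) = 1 := by
  simp [mlen]

lemma zero_mem_midxLe (n : ℕ) : (0 : Fin 5 → ℕ) ∈ midxLe n := by
  rw [midxLe, Finset.mem_filter]
  simp [mlen]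

lemma single_mem_midxLe_one (k : Fin 5) : Pi.single k 1 ∈ midxLe 1 := by
  simp only [midxLe, Finset.mem_filter, Fintype.mem_piFinset, Finset.mem_range, mlen_single,
    le_refl, and_true]
  intro a
  rw [Pi.single_apply]
  split_ifs <;> simp

lemma single_mem_midxEq1 (k : Fin 5) : Pi.single k 1 ∈ midxEq1 := by
  simp only [midxEq1, Finset.mem_filter, Fintype.mem_piFinset, Finset.mem_range, mlen_single,
    and_true]
  intro a
  rw [Pi.single_apply]
  split_ifs <;> simp

lemma abs_pd_GamI_le_sum (v : Pt → ℝ) (p : Pt) (α : Fin 3) {n : ℕ} {I : Fin 5 → ℕ}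
    (hI : I ∈ midxLe n) :
    |pd α (GamI I v) p| ≤ ∑ J ∈ midxLe n, pdNorm (GamI J v) p :=
  (abs_pd_le_pdNorm α _ p).trans (Finset.single_le_sum (f := fun J => pdNorm (GamI J v) p)
    (fun _ _ => Real.sqrt_nonneg _) hI)

lemma abs_pd_Gam_le_sum (v : Pt → ℝ) (p : Pt) (α : Fin 3) (k : Fin 5) :
    |pd α (Gam k v) p| ≤ ∑ J ∈ midxLe 1, pdNorm (GamI J v) p := by
  rw [← GamI_single]
  exact abs_pd_GamI_le_sum v p α (single_mem_midxLe_one k)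

lemma abs_pd_pd_le_sum (v : Pt → ℝ) (p : Pt) (γ α : Fin 3) :
    |pd γ (pd α v) p| ≤ ∑ J ∈ midxLe 1, pdNorm (GamI J v) p := by
  fin_cases α
  exacts [abs_pd_Gam_le_sum v p γ 0, abs_pd_Gam_le_sum v p γ 1, abs_pd_Gam_le_sum v p γ 2]

lemma abs_pd_Lb_le_sum (v : Pt → ℝ) (p : Pt) (γ : Fin 3) (c : Fin 2) :
    |pd γ (Lb c v) p| ≤ ∑ J ∈ midxLe 1, pdNorm (GamI J v) p := by
  fin_cases c
  exacts [abs_pd_Gam_le_sum v p γ 3, abs_pd_Gam_le_sum v p γ 4]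

lemma abs_Gam_le_sum (u : Pt → ℝ) (p : Pt) (k : Fin 5) :
    |Gam k u p| ≤ ∑ J ∈ midxEq1, |GamI J u p| := by
  rw [← GamI_single]
  exact Finset.single_le_sum (f := fun J => |GamI J u p|) (fun _ _ => abs_nonneg _)
    (single_mem_midxEq1 k)

lemma abs_Lb_le_sum (u : Pt → ℝ) (p : Pt) (c : Fin 2) :
    |Lb c u p| ≤ ∑ J ∈ midxEq1, |GamI J u p| := by
  fin_cases c
  exacts [abs_Gam_le_sum u p 3, abs_Gam_le_sum u p 4]

lemma abs_pd_sub_frameCoeff_mul_le (u : Pt → ℝ) {p : Pt} (hp : 0 < p 0) (β : Fin 3) :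
    |pd β u p - frameCoeff p β * pd 0 u p| ≤ (∑ J ∈ midxEq1, |GamI J u p|) / p 0 := by
  induction β using Fin.cases with
  | zero =>
    simp only [frameCoeff, Fin.cons_zero, one_mul, sub_self, abs_zero]
    exact div_nonneg (Finset.sum_nonneg fun _ _ => abs_nonneg _) hp.le
  | succ c =>
    have h : pd c.succ u p - frameCoeff p c.succ * pd 0 u p = Lb c u p / p 0 := by
      simp only [frameCoeff, Fin.cons_succ, Lb]
      field_simp
      ring
    rw [h, abs_div, abs_of_pos hp]
    gcongr
    exact abs_Lb_le_sum u p c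

lemma abs_pd_pd_sub_frameCoeff_mul_le {v : Pt → ℝ} (hv : ContDiff ℝ (⊤ : ℕ∞) v) {p : Pt}
    (hp : 0 < p 0) (γ α : Fin 3) :
    |pd γ (pd α v) p - frameCoeff p γ * pd 0 (pd α v) p| ≤
      3 * (∑ J ∈ midxLe 1, pdNorm (GamI J v) p) / p 0 := by
  set Q := ∑ J ∈ midxLe 1, pdNorm (GamI J v) p with hQ
  have hV (i : Fin 3) : |pd i v p| ≤ Q := by
    simpa [GamI_zero] using abs_pd_GamI_le_sum v p i (zero_mem_midxLe 1)
  have hQ0 : 0 ≤ Q := (abs_nonneg _).trans (hV 0)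
  induction γ using Fin.cases with
  | zero =>
    simp only [frameCoeff, Fin.cons_zero, one_mul, sub_self, abs_zero]
    positivity
  | succ c =>
    have h : pd c.succ (pd α v) p - frameCoeff p c.succ * pd 0 (pd α v) p =
        (pd α (Lb c v) p - e3 α c.succ * pd 0 v p - e3 α 0 * pd c.succ v p) / p 0 := by
      rw [pd_Lb hv, pd_comm hv c.succ α, pd_comm hv 0 α]
      simp only [frameCoeff, Fin.cons_succ]
      field_simp
      ring
    have hle (i j : Fin 3) : |e3 α i * pd j v p| ≤ Q := by
      rw [abs_mul]
      exact (mul_le_of_le_one_left (abs_nonneg _) (abs_e3_le_one α i)).trans (hV j)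
    rw [h, abs_div, abs_of_pos hp]
    gcongr
    have h₁ := abs_sub (pd α (Lb c v) p - e3 α c.succ * pd 0 v p) (e3 α 0 * pd c.succ v p)
    have h₂ := abs_sub (pd α (Lb c v) p) (e3 α c.succ * pd 0 v p)
    linarith [hle c.succ 0, hle 0 c.succ, abs_pd_Lb_le_sum v p α c]

lemma abs_pd_pd_sub_frameCoeff_mul_frameCoeff_mul_le {v : Pt → ℝ}
    (hv : ContDiff ℝ (⊤ : ℕ∞) v) {p : Pt} (hp : 0 < p 0) (hω : ∀ i, |frameCoeff p i| ≤ 1)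
    (γ α : Fin 3) :
    |pd γ (pd α v) p - frameCoeff p γ * frameCoeff p α * pd 0 (pd 0 v) p| ≤
      6 * (∑ J ∈ midxLe 1, pdNorm (GamI J v) p) / p 0 := by
  set Q := ∑ J ∈ midxLe 1, pdNorm (GamI J v) p
  have h₁ := abs_pd_pd_sub_frameCoeff_mul_le hv hp γ α
  have h₂ := abs_pd_pd_sub_frameCoeff_mul_le hv hp α 0
  rw [pd_comm hv α 0] at h₂
  have h₃ := mul_le_of_le_one_left
    (abs_nonneg (pd 0 (pd α v) p - frameCoeff p α * pd 0 (pd 0 v) p)) (hω γ)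
  rw [← abs_mul] at h₃
  calc _ = |(pd γ (pd α v) p - frameCoeff p γ * pd 0 (pd α v) p) +
        frameCoeff p γ * (pd 0 (pd α v) p - frameCoeff p α * pd 0 (pd 0 v) p)| := by
        congr 1; ring
    _ ≤ 3 * Q / p 0 + 3 * Q / p 0 := (abs_add_le _ _).trans (by linarith)
    _ = _ := by ring

lemma abs_sum_mul_le (P X : Fin 3 → Fin 3 → Fin 3 → ℝ) {B : ℝ} (hX : ∀ γ α β, |X γ α β| ≤ B) :
    |∑ γ, ∑ α, ∑ β, P γ α β * X γ α β| ≤ (∑ γ, ∑ α, ∑ β, |P γ α β|) * B := by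
  simp only [Finset.sum_mul]
  refine (Finset.abs_sum_le_sum_abs _ _).trans (Finset.sum_le_sum fun γ _ => ?_)
  refine (Finset.abs_sum_le_sum_abs _ _).trans (Finset.sum_le_sum fun α _ => ?_)
  refine (Finset.abs_sum_le_sum_abs _ _).trans (Finset.sum_le_sum fun β _ => ?_)
  rw [abs_mul]
  gcongr
  exact hX γ α β

lemma abs_mul_mul_sub_mul_mul_le {a b c a' b' c' d : ℝ} (hb : |b| ≤ 1) (hc : |c| ≤ 1)
    (ha' : |a'| ≤ 1) (hb' : |b'| ≤ 1)
    (had : |a - a'| ≤ d) (hbd : |b - b'| ≤ d) (hcd : |c - c'| ≤ d) :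
    |a * b * c - a' * b' * c'| ≤ 3 * d := by
  have hd : 0 ≤ d := (abs_nonneg _).trans had
  have h₁ : |(a - a') * (b * c)| ≤ d * (1 * 1) := by rw [abs_mul, abs_mul]; gcongr
  have h₂ : |(b - b') * (a' * c)| ≤ d * (1 * 1) := by rw [abs_mul, abs_mul]; gcongr
  have h₃ : |(c - c') * (a' * b')| ≤ d * (1 * 1) := by rw [abs_mul, abs_mul]; gcongr
  calc _ = |(a - a') * (b * c) + (b - b') * (a' * c) + (c - c') * (a' * b')| := by
        congr 1; ring
    _ ≤ _ := abs_add_three _ _ _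
    _ ≤ _ := by linarith

lemma abs_apply_le_one {ω : Pt} (h0 : ω 0 = 1) (hω : ω 1 ^ 2 + ω 2 ^ 2 ≤ 1) (i : Fin 3) :
    |ω i| ≤ 1 := by
  rw [← sq_le_one_iff_abs_le_one]
  fin_cases i
  · change ω 0 ^ 2 ≤ 1
    simp [h0]
  · change ω 1 ^ 2 ≤ 1
    nlinarith [sq_nonneg (ω 2)]
  · change ω 2 ^ 2 ≤ 1
    nlinarith [sq_nonneg (ω 1)]

lemma NullCond.abs_sum_le {P : Fin 3 → Fin 3 → Fin 3 → ℝ} (hP : NullCond P) {ω : Pt}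
    (h0 : ω 0 = 1) (hω : ω 1 ^ 2 + ω 2 ^ 2 ≤ 1) :
    |∑ γ, ∑ α, ∑ β, P γ α β * (ω γ * ω α * ω β)| ≤
      (∑ γ, ∑ α, ∑ β, |P γ α β|) * (3 * (1 - ω 1 ^ 2 - ω 2 ^ 2)) := by
  set r := √(ω 1 ^ 2 + ω 2 ^ 2) with hr
  have hr0 : 0 ≤ r := Real.sqrt_nonneg _
  have hr2 : r ^ 2 = ω 1 ^ 2 + ω 2 ^ 2 := Real.sq_sqrt (by positivity)
  have hr1 : r ≤ 1 := Real.sqrt_le_one.mpr hω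
  let ξ : Pt := ![r, ω 1, ω 2]
  have hnull := hP ξ hr2
  have hω1 (i : Fin 3) : |ω i| ≤ 1 := abs_apply_le_one h0 hω i
  have hξ1 (i : Fin 3) : |ξ i| ≤ 1 := by
    fin_cases i
    exacts [abs_le.mpr ⟨by change -1 ≤ r; linarith, hr1⟩, hω1 1, hω1 2]
  have hd (i : Fin 3) : |ω i - ξ i| ≤ 1 - ω 1 ^ 2 - ω 2 ^ 2 := by
    fin_cases i
    · change |ω 0 - r| ≤ _
      rw [h0, abs_of_nonneg (by linarith)]
      nlinarith
    · change |ω 1 - ω 1| ≤ _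
      rw [sub_self, abs_zero]; linarith
    · change |ω 2 - ω 2| ≤ _
      rw [sub_self, abs_zero]; linarith
  calc _ = |∑ γ, ∑ α, ∑ β, P γ α β * (ω γ * ω α * ω β - ξ γ * ξ α * ξ β)| := by
        rw [← sub_zero (∑ γ, ∑ α, ∑ β, P γ α β * (ω γ * ω α * ω β)), ← hnull]
        simp only [← Finset.sum_sub_distrib]
        refine congrArg _ <| Finset.sum_congr rfl fun γ _ => Finset.sum_congr rfl fun α _ =>
          Finset.sum_congr rfl fun β _ => ?_
        ring
    _ ≤ _ := abs_sum_mul_le _ _ fun γ α β => abs_mul_mul_sub_mul_mul_le (hω1 α) (hω1 β)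
        (hξ1 γ) (hξ1 α) (hd γ) (hd α) (hd β)

/-- estimate of the null form `P^{γαβ}∂_γ∂_αv ∂_βu`. -/
theorem nullform_estimate_second
    (P : Fin 3 → Fin 3 → Fin 3 → ℝ) (hP : NullCond P) :
    ∃ C > (0:ℝ), ∀ u v : Pt → ℝ,
      ContDiff ℝ (⊤ : ℕ∞) u → ContDiff ℝ (⊤ : ℕ∞) v →
      Function.support u ⊆ Cone → Function.support v ⊆ Cone →
      ∀ p ∈ Cone,
        |∑ γ, ∑ α, ∑ β, P γ α β * pd γ (pd α v) p * pd β u p| ≤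
          C * ((sVar p) ^ 2 / (p 0) ^ 2 * |pd 0 (pd 0 v) p * pd 0 u p|
            + (1 / p 0) * ∑ I₁ ∈ midxLe 1, ∑ I₂ ∈ midxEq1,
                pdNorm (GamI I₁ v) p * |GamI I₂ u p|) := by
  set M := ∑ γ, ∑ α, ∑ β, |P γ α β| with hM
  have hM0 : 0 ≤ M := by positivity
  refine ⟨7 * M + 1, by positivity, fun u v _ hv _ _ p hp => ?_⟩
  have ht : 0 < p 0 := by linarith [hp.1]
  have hx : p 1 ^ 2 + p 2 ^ 2 ≤ p 0 ^ 2 :=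
    (Real.sqrt_le_left ht.le).mp (by linarith [show √(p 1 ^ 2 + p 2 ^ 2) < p 0 - 1 from hp.2])
  set ω := frameCoeff p with hω
  have h0 : ω 0 = 1 := rfl
  have h1 : ω 1 = -(p 1 / p 0) := rfl
  have h2 : ω 2 = -(p 2 / p 0) := rfl
  have hs : 1 - ω 1 ^ 2 - ω 2 ^ 2 = sVar p ^ 2 / p 0 ^ 2 := by
    rw [sVar, Real.sq_sqrt (by linarith), h1, h2]
    field_simp
  have hs0 : 0 ≤ sVar p ^ 2 / p 0 ^ 2 := by positivity
  have hω1 (i : Fin 3) : |ω i| ≤ 1 := abs_apply_le_one h0 (by linarith) i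
  rw [← Finset.sum_mul_sum]
  set Q := ∑ J ∈ midxLe 1, pdNorm (GamI J v) p with hQ
  set R := ∑ J ∈ midxEq1, |GamI J u p| with hR
  have hQ0 : 0 ≤ Q := (abs_nonneg _).trans (abs_pd_pd_le_sum v p 0 0)
  have hR0 : 0 ≤ R := (abs_nonneg _).trans (abs_Gam_le_sum u p 0)
  have hX (γ α β : Fin 3) : |pd γ (pd α v) p * pd β u p -
      ω γ * ω α * ω β * (pd 0 (pd 0 v) p * pd 0 u p)| ≤ 7 * (1 / p 0 * (Q * R)) := by
    have hH : |pd γ (pd α v) p * (pd β u p - ω β * pd 0 u p)| ≤ Q * (R / p 0) := by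
      rw [abs_mul]
      gcongr
      exacts [abs_pd_pd_le_sum v p γ α, abs_pd_sub_frameCoeff_mul_le u ht β]
    have hU : |(pd γ (pd α v) p - ω γ * ω α * pd 0 (pd 0 v) p) * (ω β * pd 0 u p)| ≤
        6 * Q / p 0 * (1 * R) := by
      rw [abs_mul, abs_mul]
      gcongr
      exacts [abs_pd_pd_sub_frameCoeff_mul_frameCoeff_mul_le hv ht hω1 γ α, hω1 β,
        abs_Gam_le_sum u p 0]
    calc _ = |pd γ (pd α v) p * (pd β u p - ω β * pd 0 u p) +
          (pd γ (pd α v) p - ω γ * ω α * pd 0 (pd 0 v) p) * (ω β * pd 0 u p)| := by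
          congr 1; ring
      _ ≤ _ := (abs_add_le _ _).trans (add_le_add hH hU)
      _ = _ := by ring
  have hnull := hP.abs_sum_le h0 (by linarith)
  rw [hs, ← hM] at hnull
  have hrest := abs_sum_mul_le P _ hX
  rw [← hM] at hrest
  have hsplit : ∑ γ, ∑ α, ∑ β, P γ α β * pd γ (pd α v) p * pd β u p =
      (∑ γ, ∑ α, ∑ β, P γ α β * (pd γ (pd α v) p * pd β u p -
        ω γ * ω α * ω β * (pd 0 (pd 0 v) p * pd 0 u p))) +
      (∑ γ, ∑ α, ∑ β, P γ α β * (ω γ * ω α * ω β)) * (pd 0 (pd 0 v) p * pd 0 u p) := by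
    simp only [Finset.sum_mul, ← Finset.sum_add_distrib]
    refine Finset.sum_congr rfl fun γ _ => Finset.sum_congr rfl fun α _ =>
      Finset.sum_congr rfl fun β _ => ?_
    ring
  have hmain := mul_le_mul_of_nonneg_right hnull (abs_nonneg (pd 0 (pd 0 v) p * pd 0 u p))
  rw [← abs_mul] at hmain
  have hA : 0 ≤ sVar p ^ 2 / p 0 ^ 2 * |pd 0 (pd 0 v) p * pd 0 u p| := by positivity
  have hB : 0 ≤ 1 / p 0 * (Q * R) := by positivity
  rw [hsplit]
  refine (abs_add_le _ _).trans ((add_le_add hrest hmain).trans ?_)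
  nlinarith [mul_nonneg hM0 hA]
end
end

section
/- Let δ > 0 and let g : [2,∞) × ℝ² → ℝ be measurable and supported in the cone K. Then for any 4 ≤ T₁ < T₂ < +∞ one has ∫_{T₁}^{T₂} ∫_{|x| < τ−1} |g(τ,x)|² τ^{1+δ} dx dτ ≤ C ∫_{√T₁}^{T₂} ‖g‖²_{L²_f(H_s)} s^{1+2δ} ds, where the constant C is independent of g, T₁, T₂ (and may depend on δ). -/
open MeasureTheory Real Filter Topology
open scoped ENNReal NNReal

noncomputable section

/-- In the interior region `√a < τ - 1`, passing from the time variable `τ` to the hyperbolic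
time `s = √(τ² - a)` trades the weight `τ ^ (1 + δ)` for `s ^ (1 + 2 * δ)`. -/
lemma setLIntegral_time_le_setLIntegral_hyperbolic_time {δ : ℝ} (hδ : 0 ≤ δ) {a T₁ T₂ : ℝ}
    (ha : 0 ≤ a) (hT₁ : 1 ≤ T₁) (F : ℝ → ℝ≥0∞) :
    ∫⁻ τ in Set.Ioc T₁ T₂ ∩ {τ | a < (τ - 1) ^ 2}, F τ * ENNReal.ofReal (τ ^ (1 + δ)) ≤
      ∫⁻ s in Set.Ioc (√T₁) T₂, F √(s ^ 2 + a) * ENNReal.ofReal (s ^ (1 + 2 * δ)) := by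
  set A : Set ℝ := Set.Ioc T₁ T₂ ∩ {τ | a < (τ - 1) ^ 2}
  set f : ℝ → ℝ := fun s => √(s ^ 2 + a) with hf
  set B : Set ℝ := Set.Ioc (√T₁) T₂ ∩ f ⁻¹' A
  have hA_meas : MeasurableSet A :=
    measurableSet_Ioc.inter (measurableSet_lt (by fun_prop) (by fun_prop))
  have hB_meas : MeasurableSet B :=
    measurableSet_Ioc.inter (hA_meas.preimage (by fun_prop))
  have hpos : ∀ s ∈ B, 0 < s := fun s hs => (Real.sqrt_nonneg _).trans_lt hs.1.1
  have hderiv : ∀ s ∈ B, HasDerivWithinAt f (s / f s) B s := by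
    intro s hs
    have h := (((hasDerivAt_id s).pow 2).add_const a).sqrt
      (by have := hpos s hs; simp only [id, Pi.pow_apply]; positivity)
    refine (h.congr_deriv ?_).hasDerivWithinAt
    simp only [hf, id, Pi.pow_apply]
    have := hpos s hs
    field_simp
    norm_num
  have hinj : Set.InjOn f B := by
    intro s hs t ht hst
    have hs0 := hpos s hs
    have ht0 := hpos t ht
    have h := (Real.sqrt_inj (by positivity) (by positivity)).1 hst
    nlinarith
  have himage : A ⊆ f '' B := by
    intro τ hτ
    obtain ⟨⟨h₁, h₂⟩, h₃ : a < (τ - 1) ^ 2⟩ := hτ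
    have hfτ : f √(τ ^ 2 - a) = τ := by
      simp only [hf]
      rw [Real.sq_sqrt (by nlinarith), sub_add_cancel, Real.sqrt_sq (by linarith)]
    refine ⟨√(τ ^ 2 - a), ⟨⟨Real.sqrt_lt_sqrt (by linarith) (by nlinarith), ?_⟩, ?_⟩, hfτ⟩
    · exact (Real.sqrt_le_left (by linarith)).2 (by nlinarith)
    · exact Set.mem_preimage.2 (hfτ.symm ▸ ⟨⟨h₁, h₂⟩, h₃⟩)
  calc ∫⁻ τ in A, F τ * ENNReal.ofReal (τ ^ (1 + δ))
      ≤ ∫⁻ τ in f '' B, F τ * ENNReal.ofReal (τ ^ (1 + δ)) := lintegral_mono_set himage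
    _ = ∫⁻ s in B, ENNReal.ofReal |s / f s| * (F (f s) * ENNReal.ofReal (f s ^ (1 + δ))) :=
        lintegral_image_eq_lintegral_abs_deriv_mul hB_meas hderiv hinj _
    _ ≤ ∫⁻ s in B, F (f s) * ENNReal.ofReal (s ^ (1 + 2 * δ)) := by
        refine setLIntegral_mono' hB_meas fun s hs => ?_
        rw [mul_left_comm, ← ENNReal.ofReal_mul (abs_nonneg _)]
        gcongr
        have hs0 := hpos s hs
        have hfs : 0 < f s := by simp only [hf]; positivity
        have hsq : f s ^ 2 = s ^ 2 + a := Real.sq_sqrt (by positivity)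
        obtain ⟨-, ⟨h₁, -⟩, h₃ : a < (f s - 1) ^ 2⟩ := hs
        have hle : f s ≤ s ^ 2 := by nlinarith
        rw [abs_of_pos (by positivity), Real.rpow_add hfs, Real.rpow_add hs0, Real.rpow_one,
          Real.rpow_one, ← mul_assoc, div_mul_cancel₀ _ hfs.ne', Real.rpow_mul hs0.le,
          Real.rpow_two]
        gcongr
    _ ≤ ∫⁻ s in Set.Ioc (√T₁) T₂, F (f s) * ENNReal.ofReal (s ^ (1 + 2 * δ)) :=
        lintegral_mono_set Set.inter_subset_left

/-- change of variables from flat time slices to hyperboloids. -/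
theorem flat_to_hyperboloid_change_of_variables (δ : ℝ) (hδ : 0 < δ) :
    ∃ C > (0:ℝ), ∀ g : Pt → ℝ, Measurable g → Function.support g ⊆ Cone →
      ∀ T₁ T₂ : ℝ, 4 ≤ T₁ → T₁ < T₂ →
        (∫⁻ τ in Set.Ioc T₁ T₂,
            (∫⁻ x in {x : Fin 2 → ℝ | (x 0) ^ 2 + (x 1) ^ 2 < (τ - 1) ^ 2},
                ENNReal.ofReal ((g ![τ, x 0, x 1]) ^ 2))
              * ENNReal.ofReal (τ ^ (1 + δ)))
          ≤ ENNReal.ofReal C *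
            ∫⁻ s in Set.Ioc (Real.sqrt T₁) T₂,
              (∫⁻ x : Fin 2 → ℝ, ENNReal.ofReal ((g (hypPt s x)) ^ 2))
                * ENNReal.ofReal (s ^ (1 + 2 * δ)) := by
  refine ⟨1, one_pos, fun g hg _ T₁ T₂ hT₁ _ => ?_⟩
  rw [ENNReal.ofReal_one, one_mul]
  set E : Set (ℝ × (Fin 2 → ℝ)) := {p | p.2 0 ^ 2 + p.2 1 ^ 2 < (p.1 - 1) ^ 2}
  have hE_meas : MeasurableSet E := measurableSet_lt (by fun_prop) (by fun_prop)
  set G : ℝ × (Fin 2 → ℝ) → ℝ≥0∞ := fun p =>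
    ENNReal.ofReal (g ![p.1, p.2 0, p.2 1] ^ 2) * ENNReal.ofReal (p.1 ^ (1 + δ))
  have hvec : ∀ {t : ℝ × (Fin 2 → ℝ) → ℝ}, Measurable t →
      Measurable fun p => g ![t p, p.2 0, p.2 1] := by
    intro t ht
    refine hg.comp (measurable_pi_iff.2 fun i => ?_)
    fin_cases i
    · exact ht
    · exact (measurable_pi_apply 0).comp measurable_snd
    · exact (measurable_pi_apply 1).comp measurable_snd
  have hG_meas : Measurable G := by
    have := hvec measurable_fst
    fun_prop
  have hH_meas : Measurable fun p : ℝ × (Fin 2 → ℝ) =>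
      ENNReal.ofReal (g (hypPt p.1 p.2) ^ 2) * ENNReal.ofReal (p.1 ^ (1 + 2 * δ)) := by
    have : Measurable fun p : ℝ × (Fin 2 → ℝ) => g (hypPt p.1 p.2) := hvec (by fun_prop)
    exact (this.pow_const 2).ennreal_ofReal.mul (by fun_prop)
  calc _ = ∫⁻ τ in Set.Ioc T₁ T₂, ∫⁻ x, E.indicator G (τ, x) := by
        refine lintegral_congr fun τ => ?_
        rw [← lintegral_mul_const' _ _ ENNReal.ofReal_ne_top,
          ← lintegral_indicator (measurableSet_lt (by fun_prop) (by fun_prop))]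
        rfl
    _ = ∫⁻ x, ∫⁻ τ in Set.Ioc T₁ T₂, E.indicator G (τ, x) :=
        lintegral_lintegral_swap (hG_meas.indicator hE_meas).aemeasurable
    _ = ∫⁻ x : Fin 2 → ℝ, ∫⁻ τ in Set.Ioc T₁ T₂ ∩ {τ | x 0 ^ 2 + x 1 ^ 2 < (τ - 1) ^ 2},
          G (τ, x) := by
        refine lintegral_congr fun x => ?_
        rw [Set.inter_comm, ← setLIntegral_indicator
          (measurableSet_lt (by fun_prop) (by fun_prop))]
        rfl
    _ ≤ ∫⁻ x : Fin 2 → ℝ, ∫⁻ s in Set.Ioc (√T₁) T₂,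
          ENNReal.ofReal (g (hypPt s x) ^ 2) * ENNReal.ofReal (s ^ (1 + 2 * δ)) := by
        refine lintegral_mono fun x => ?_
        simp only [hypPt, add_assoc]
        exact setLIntegral_time_le_setLIntegral_hyperbolic_time hδ.le (by positivity)
          (by linarith) fun τ => ENNReal.ofReal (g ![τ, x 0, x 1] ^ 2)
    _ = ∫⁻ s in Set.Ioc (√T₁) T₂, ∫⁻ x : Fin 2 → ℝ,
          ENNReal.ofReal (g (hypPt s x) ^ 2) * ENNReal.ofReal (s ^ (1 + 2 * δ)) :=
        (lintegral_lintegral_swap hH_meas.aemeasurable).symm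
    _ = _ := lintegral_congr fun s => lintegral_mul_const' _ _ ENNReal.ofReal_ne_top
end
end
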